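/- Let m ≥ 1 and T be positive integers, and let a_1, ..., a_{3m} be positive integers with T/4 < a_j < T/2 for all j and Σ_{j=1}^{3m} a_j = mT. Consider the instance with agents 1, ..., m+1 and items o_1, ..., o_{3m}, g_1, ..., g_{m+2}, where for each agent i ≤ m: u_i(o_j) = a_j and u_i(g_k) = T for all k; and for agent m+1: u_{m+1}(o_j) = 0 and u_{m+1}(g_k) = (1 + m/(m+2))·T for all k. Then there exists an allocation that is both utilitarian-maximal and PROP1 if and only if the index set {1, ..., 3m} can be partitioned into m pairwise disjoint triples such that Σ_{j ∈ triple} a_j = T for each triple. -/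

import Mathlib

open Finset

/-- An allocation: bundles are pairwise disjoint and every item is allocated. -/
def IsAllocation {A I : Type*} (p : A → Finset I) : Prop :=
  (∀ i j : A, i ≠ j → Disjoint (p i) (p j)) ∧ ∀ o : I, ∃ i : A, o ∈ p i

/-- Utilitarian welfare of an allocation. -/
def welfare {A I : Type*} [Fintype A] (u : A → I → ℚ) (p : A → Finset I) : ℚ :=
  ∑ i : A, ∑ o ∈ p i, u i o

/-- Utilitarian-maximal allocation: an allocation whose welfare is maximal among allocations. -/
def IsUM {A I : Type*} [Fintype A] (u : A → I → ℚ) (p : A → Finset I) : Prop :=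
  IsAllocation p ∧ ∀ q : A → Finset I, IsAllocation q → welfare u q ≤ welfare u p

/-- Envy-freeness up to one item. -/
def EF1 {A I : Type*} [DecidableEq I] (u : A → I → ℚ) (p : A → Finset I) : Prop :=
  ∀ i j : A, ∃ O' ⊆ p j, O'.card ≤ 1 ∧ ∑ o ∈ p i, u i o ≥ ∑ o ∈ p j \ O', u i o

/-- Envy-freeness up to any item. -/
def EFx {A I : Type*} [DecidableEq I] (u : A → I → ℚ) (p : A → Finset I) : Prop :=
  ∀ i j : A, ∀ o ∈ p j, ∑ o' ∈ p i, u i o' ≥ ∑ o' ∈ (p j).erase o, u i o'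

/-- Proportionality up to one item. -/
def PROP1 {A I : Type*} [Fintype A] [Fintype I] [DecidableEq I]
    (u : A → I → ℚ) (p : A → Finset I) : Prop :=
  ∀ i : A, ∃ O' ⊆ Finset.univ \ p i, O'.card ≤ 1 ∧
    ∑ o ∈ p i ∪ O', u i o ≥ (∑ o : I, u i o) / (Fintype.card A : ℚ)

/-- Proportionality up to any item. -/
def PROPx {A I : Type*} [Fintype A] [Fintype I] [DecidableEq I]
    (u : A → I → ℚ) (p : A → Finset I) : Prop :=
  ∀ i : A, ∀ o ∈ Finset.univ \ p i,
    ∑ o' ∈ insert o (p i), u i o' ≥ (∑ o' : I, u i o') / (Fintype.card A : ℚ)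

section UtilitarianMaximal

variable {A I : Type*} [DecidableEq A] [Fintype I]

theorem isAllocation_fibers (f : I → A) :
    IsAllocation fun i => univ.filter fun o => f o = i := by
  refine ⟨fun i j hij => ?_, fun o => ⟨f o, by simp⟩⟩
  rw [Finset.disjoint_left]
  intro o hi hj
  simp only [mem_filter, mem_univ, true_and] at hi hj
  exact hij (hi.symm.trans hj)

theorem IsAllocation.exists_eq_fibers {p : A → Finset I} (hp : IsAllocation p) :
    ∃ f : I → A, p = fun i => univ.filter fun o => f o = i := by
  choose f hf using hp.2
  refine ⟨f, ?_⟩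
  ext i o
  simp only [mem_filter, mem_univ, true_and]
  constructor
  · intro h
    by_contra hne
    exact Finset.disjoint_left.1 (hp.1 _ _ hne) (hf o) h
  · rintro rfl
    exact hf o

theorem welfare_fibers [Fintype A] (u : A → I → ℚ) (f : I → A) :
    (welfare u fun i => univ.filter fun o => f o = i) = ∑ o, u (f o) o := by
  unfold welfare
  rw [← Finset.sum_fiberwise univ f]
  refine sum_congr rfl fun i _ => sum_congr rfl fun o ho => ?_
  rw [(mem_filter.1 ho).2]

theorem isUM_fibers_iff [Fintype A] (u : A → I → ℚ) (f : I → A) :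
    (IsUM u fun i => univ.filter fun o => f o = i) ↔ ∀ o i, u i o ≤ u (f o) o := by
  classical
  constructor
  · rintro ⟨-, h⟩ o i
    have h' := h _ (isAllocation_fibers (Function.update f o i))
    rw [welfare_fibers, welfare_fibers, ← add_sum_erase _ _ (mem_univ o),
      ← add_sum_erase univ (fun x => u (f x) x) (mem_univ o)] at h'
    have hrest : ∑ x ∈ univ.erase o, u (Function.update f o i x) x
        = ∑ x ∈ univ.erase o, u (f x) x :=
      sum_congr rfl fun x hx => by rw [Function.update_of_ne (ne_of_mem_erase hx)]
    rw [hrest, Function.update_self] at h'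
    exact le_of_add_le_add_right h'
  · refine fun h => ⟨isAllocation_fibers f, fun q hq => ?_⟩
    obtain ⟨g, rfl⟩ := hq.exists_eq_fibers
    rw [welfare_fibers, welfare_fibers]
    exact sum_le_sum fun o _ => h o (g o)

end UtilitarianMaximal

theorem sum_le_of_card_le_one {I : Type*} {s : Finset I} (hs : s.card ≤ 1) {v : I → ℚ} {c : ℚ}
    (hc : 0 ≤ c) (hv : ∀ o, v o ≤ c) : ∑ o ∈ s, v o ≤ c := by
  calc ∑ o ∈ s, v o ≤ s.card • c := sum_le_card_nsmul _ _ _ fun o _ => hv o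
    _ ≤ 1 • c := nsmul_le_nsmul_left hc hs
    _ = c := one_nsmul c

theorem card_eq_three_of_sum_eq {ι : Type*} {s : Finset ι} {a : ι → ℕ} {T : ℕ} (hT : 0 < T)
    (ha : ∀ j ∈ s, T < 4 * a j ∧ 2 * a j < T) (hs : ∑ j ∈ s, a j = T) : s.card = 3 := by
  have hne : s.Nonempty := by
    rw [nonempty_iff_ne_empty]
    rintro rfl
    simp at hs
    omega
  have h1 : ∑ _j ∈ s, T < ∑ j ∈ s, 4 * a j := sum_lt_sum_of_nonempty hne fun j hj => (ha j hj).1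
  have h2 : ∑ j ∈ s, 2 * a j < ∑ _j ∈ s, T := sum_lt_sum_of_nonempty hne fun j hj => (ha j hj).2
  rw [← mul_sum, hs, sum_const, smul_eq_mul] at h1 h2
  have h3 := lt_of_mul_lt_mul_right h1 (Nat.zero_le T)
  have h4 := lt_of_mul_lt_mul_right h2 (Nat.zero_le T)
  omega

/-- For the 3-Partition reduction instance (with m+2 extra items), a UM
and PROP1 allocation exists iff the integers can be partitioned into m triples each
summing to T. -/
theorem exists_um_prop1_iff_three_partition
    (m T : ℕ) (hm : 1 ≤ m) (hT : 0 < T)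
    (a : Fin (3 * m) → ℕ) (ha0 : ∀ j, 0 < a j)
    (ha : ∀ j, T < 4 * a j ∧ 2 * a j < T)
    (hsum : ∑ j, a j = m * T)
    (u : Fin (m + 1) → (Fin (3 * m) ⊕ Fin (m + 2)) → ℚ)
    (hu1 : ∀ i : Fin (m + 1), (i : ℕ) < m → ∀ j, u i (Sum.inl j) = a j)
    (hu2 : ∀ i : Fin (m + 1), (i : ℕ) < m → ∀ k, u i (Sum.inr k) = T)
    (hu3 : ∀ j, u (Fin.last m) (Sum.inl j) = 0)
    (hu4 : ∀ k, u (Fin.last m) (Sum.inr k) = (1 + (m : ℚ) / (m + 2)) * T) :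
    (∃ p : Fin (m + 1) → Finset (Fin (3 * m) ⊕ Fin (m + 2)), IsUM u p ∧ PROP1 u p) ↔
    (∃ f : Fin (3 * m) → Fin m, ∀ k : Fin m,
      (Finset.univ.filter fun j => f j = k).card = 3 ∧
      ∑ j ∈ Finset.univ.filter (fun j => f j = k), a j = T) := by
  have hT' : (0 : ℚ) < T := by exact_mod_cast hT
  have hsum' : ∑ j, (a j : ℚ) = m * T := by exact_mod_cast hsum
  have hO : ∀ k : Fin m, ∀ j, u k.castSucc (Sum.inl j) = a j := fun k => hu1 _ k.isLt
  have hG : ∀ k : Fin m, ∀ g, u k.castSucc (Sum.inr g) = T := fun k => hu2 _ k.isLt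
  have hgt : (T : ℚ) < (1 + (m : ℚ) / (m + 2)) * T := by
    have : (0 : ℚ) < (m : ℚ) / (m + 2) := by positivity
    nlinarith
  have hshare : ∀ i, (∑ o, u i o) / (Fintype.card (Fin (m + 1)) : ℚ) = 2 * T := by
    intro i
    rw [Fintype.card_fin, Fintype.sum_sum_type]
    refine Fin.lastCases ?_ (fun k => ?_) i
    · simp only [hu3, hu4, sum_const, card_univ, Fintype.card_fin, nsmul_eq_mul]
      push_cast
      field_simp
      ring
    · simp only [hO, hG, sum_const, card_univ, Fintype.card_fin, nsmul_eq_mul, hsum']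
      push_cast
      field_simp
      ring
  constructor
  · rintro ⟨p, hUM, hP⟩
    obtain ⟨f, rfl⟩ := hUM.1.exists_eq_fibers
    rw [isUM_fibers_iff] at hUM
    have hfG : ∀ (g) (k : Fin m), f (Sum.inr g) ≠ k.castSucc := by
      intro g k h
      have h' := hUM (Sum.inr g) (Fin.last m)
      rw [h, hu4, hG] at h'
      linarith
    have hfO : ∀ j, f (Sum.inl j) ≠ Fin.last m := by
      intro j h
      have h' := hUM (Sum.inl j) (Fin.castSucc ⟨0, hm⟩)
      rw [h, hu3, hO] at h'
      exact absurd (ha0 j) (by exact_mod_cast h'.not_gt)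
    choose f' hf' using fun j => Fin.exists_castSucc_eq.2 (hfO j)
    have hbundle : ∀ k : Fin m,
        ∑ o ∈ univ.filter (fun o => f o = k.castSucc), u k.castSucc o =
          ((∑ j ∈ univ.filter (fun j => f' j = k), a j : ℕ) : ℚ) := by
      intro k
      rw [sum_filter, Fintype.sum_sum_type]
      simp [hfG, ← hf', hO, sum_filter]
    have hle : ∀ k ∈ (univ : Finset (Fin m)), T ≤ ∑ j ∈ univ.filter (fun j => f' j = k), a j := by
      intro k _
      obtain ⟨O', hsub, hcard, hge⟩ := hP k.castSucc
      rw [hshare, sum_union (disjoint_of_subset_right hsub disjoint_sdiff), hbundle] at hge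
      have hO' : ∑ o ∈ O', u k.castSucc o ≤ T := by
        refine sum_le_of_card_le_one hcard hT'.le ?_
        rintro (j | g)
        · rw [hO]
          have := (ha j).2
          exact_mod_cast (by omega : a j ≤ T)
        · rw [hG]
      have : (T : ℚ) ≤ ((∑ j ∈ univ.filter (fun j => f' j = k), a j : ℕ) : ℚ) := by linarith
      exact_mod_cast this
    have htotal : ∑ _k : Fin m, T = ∑ k, ∑ j ∈ univ.filter (fun j => f' j = k), a j := by
      rw [sum_fiberwise, hsum]
      simp
    have heq := (sum_eq_sum_iff_of_le hle).1 htotal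
    exact ⟨f', fun k => ⟨card_eq_three_of_sum_eq hT (fun j _ => ha j) (heq k (mem_univ k)).symm,
      (heq k (mem_univ k)).symm⟩⟩
  · rintro ⟨f, hf⟩
    refine ⟨fun i => univ.filter fun o =>
      Sum.elim (fun j => (f j).castSucc) (fun _ => Fin.last m) o = i, ?_, ?_⟩
    · rw [isUM_fibers_iff]
      rintro (j | g) i
      · refine Fin.lastCases ?_ (fun k => ?_) i
        · simp [hu3, hO]
        · simp [hO]
      · refine Fin.lastCases ?_ (fun k => ?_) i
        · simp
        · simpa only [Sum.elim_inr, hG, hu4] using hgt.le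
    · intro i
      rw [hshare]
      refine Fin.lastCases ?_ (fun k => ?_) i
      · refine ⟨∅, empty_subset _, by simp, ?_⟩
        rw [union_empty, sum_filter, Fintype.sum_sum_type]
        simp only [Sum.elim_inl, Sum.elim_inr, hu3, hu4, ite_self, sum_const_zero, zero_add,
          if_true, sum_const, card_univ, Fintype.card_fin, nsmul_eq_mul]
        have h2 : (2 : ℚ) ≤ ((m + 2 : ℕ) : ℚ) := by exact_mod_cast Nat.le_add_left 2 m
        exact mul_le_mul h2 hgt.le hT'.le (by positivity)
      · have hlast : Fin.last m ≠ k.castSucc := (Fin.castSucc_lt_last k).ne'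
        refine ⟨{Sum.inr 0}, by simp [hlast], by simp, ?_⟩
        rw [sum_union (by simp [hlast]), sum_singleton, hG, sum_filter, Fintype.sum_sum_type]
        have hk : ∑ j, (if f j = k then (a j : ℚ) else 0) = T := by
          rw [← sum_filter]
          exact_mod_cast (hf k).2
        simp only [Sum.elim_inl, Sum.elim_inr, hlast, if_false, sum_const_zero, add_zero,
          Fin.castSucc_inj, hO, hk]
        linarith
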